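/- (Lower bound for the lapse.) Let (η, λ, r, s) be a regular solution on [1,T) and set C₀ = sup_{y∈ℝ} e^{−2η(1,y)}. Then for every (t,x) ∈ [1,T) × ℝ one has e^{2η(t,x)} ≥ t / (C₀ + (Λ/3) t³). -/

import Mathlib

open Real Set MeasureTheory

noncomputable section

/-- Partial derivative with respect to the time variable `t`. -/
def pderivT (f : ℝ → ℝ → ℝ) (t x : ℝ) : ℝ := deriv (fun τ => f τ x) t

/-- Partial derivative with respect to the space variable `x`. -/
def pderivX (f : ℝ → ℝ → ℝ) (t x : ℝ) : ℝ := deriv (fun y => f t y) x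

/-- The time interval `[1, T)` for a (possibly infinite) final time `T ∈ (1,∞]`. -/
def timeSlab (T : EReal) : Set ℝ := {t : ℝ | 1 ≤ t ∧ (t : EReal) < T}

/-- A regular solution of the plane-symmetric Einstein–stiff fluid equations in areal
coordinates, with cosmological constant `Λ`, on a time interval `J`:
continuously differentiable functions `η, λ, r, s`, 1-periodic in the space variable,
with `r ≥ 0`, `s ≥ 0`, satisfying the evolution and constraint equations (E1)–(E5). -/
structure RegularSolution (Λ : ℝ) (J : Set ℝ) where
  η : ℝ → ℝ → ℝ
  lam : ℝ → ℝ → ℝ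
  r : ℝ → ℝ → ℝ
  s : ℝ → ℝ → ℝ
  η_c1 : ContDiffOn ℝ 1 (fun p : ℝ × ℝ => η p.1 p.2) (J ×ˢ (Set.univ : Set ℝ))
  lam_c1 : ContDiffOn ℝ 1 (fun p : ℝ × ℝ => lam p.1 p.2) (J ×ˢ (Set.univ : Set ℝ))
  r_c1 : ContDiffOn ℝ 1 (fun p : ℝ × ℝ => r p.1 p.2) (J ×ˢ (Set.univ : Set ℝ))
  s_c1 : ContDiffOn ℝ 1 (fun p : ℝ × ℝ => s p.1 p.2) (J ×ˢ (Set.univ : Set ℝ))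
  η_per : ∀ t ∈ J, ∀ x : ℝ, η t (x + 1) = η t x
  lam_per : ∀ t ∈ J, ∀ x : ℝ, lam t (x + 1) = lam t x
  r_per : ∀ t ∈ J, ∀ x : ℝ, r t (x + 1) = r t x
  s_per : ∀ t ∈ J, ∀ x : ℝ, s t (x + 1) = s t x
  r_nonneg : ∀ t ∈ J, ∀ x : ℝ, 0 ≤ r t x
  s_nonneg : ∀ t ∈ J, ∀ x : ℝ, 0 ≤ s t x
  eqE1 : ∀ t ∈ J, ∀ x : ℝ,
    Real.exp (-2 * η t x) * (2 * t * pderivT lam t x + 1) - Λ * t ^ 2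
      = 4 * Real.pi * t ^ 2 * (r t x + s t x)
  eqE2 : ∀ t ∈ J, ∀ x : ℝ,
    Real.exp (-2 * η t x) * (2 * t * pderivT η t x - 1) + Λ * t ^ 2
      = 4 * Real.pi * t ^ 2 * (r t x + s t x)
  eqE3 : ∀ t ∈ J, ∀ x : ℝ,
    pderivX η t x = -(2 * Real.pi * t * Real.exp (lam t x + η t x) * (r t x - s t x))
  eqE4 : ∀ t ∈ J, ∀ x : ℝ,
    pderivT r t x + Real.exp (η t x - lam t x) * pderivX r t x
      = -2 * (pderivT lam t x + Real.exp (η t x - lam t x) * pderivX η t x + 1 / t) * r t x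
        - 2 / t * Real.sqrt (r t x * s t x)
  eqE5 : ∀ t ∈ J, ∀ x : ℝ,
    pderivT s t x - Real.exp (η t x - lam t x) * pderivX s t x
      = -2 * (pderivT lam t x - Real.exp (η t x - lam t x) * pderivX η t x + 1 / t) * s t x
        - 2 / t * Real.sqrt (r t x * s t x)

/-- A regular solution's metric function `η` is continuous in time at fixed `x`. -/
lemma RegularSolution.continuousOn_η_time {Λ : ℝ} {J : Set ℝ} (sol : RegularSolution Λ J)
    (x : ℝ) : ContinuousOn (fun τ => sol.η τ x) J :=
  sol.η_c1.continuousOn.comp (f := fun τ : ℝ => (τ, x)) (by fun_prop)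
    (fun _ hτ => ⟨hτ, mem_univ _⟩)

/-- A regular solution's metric function `η` is continuous in space at each time. -/
lemma RegularSolution.continuous_η_space {Λ : ℝ} {J : Set ℝ} (sol : RegularSolution Λ J)
    {t : ℝ} (ht : t ∈ J) : Continuous (sol.η t) :=
  sol.η_c1.continuousOn.comp_continuous (f := fun y : ℝ => (t, y)) (by fun_prop)
    (fun _ => ⟨ht, mem_univ _⟩)

/-- In the interior of the time interval, `η` is differentiable in time. -/
lemma RegularSolution.hasDerivAt_η_time {Λ : ℝ} {J : Set ℝ} (sol : RegularSolution Λ J)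
    {t : ℝ} (ht : J ∈ nhds t) (x : ℝ) :
    HasDerivAt (fun τ => sol.η τ x) (pderivT sol.η t x) t := by
  have hd : DifferentiableAt ℝ (fun p : ℝ × ℝ => sol.η p.1 p.2) (t, x) :=
    (sol.η_c1.contDiffAt (prod_mem_nhds ht Filter.univ_mem)).differentiableAt one_ne_zero
  have hc : DifferentiableAt ℝ (fun τ : ℝ => (τ, x)) t := by fun_prop
  exact (DifferentiableAt.comp t hd hc).hasDerivAt

/-- At each time, `exp (-2η)` is bounded above in space, by periodicity. -/
lemma RegularSolution.bddAbove_exp_neg_two_η {Λ : ℝ} {J : Set ℝ} (sol : RegularSolution Λ J)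
    {t : ℝ} (ht : t ∈ J) : BddAbove (range fun y => Real.exp (-2 * sol.η t y)) := by
  have hp : Function.Periodic (fun y => Real.exp (-2 * sol.η t y)) 1 := fun y => by
    simp only [sol.η_per t ht y]
  have hc := sol.continuous_η_space ht
  exact (hp.isBounded_of_continuous one_ne_zero (by fun_prop)).bddAbove

/-- The quantity `t exp (-2η) - (Λ/3) t³` is nonincreasing in time. -/
lemma RegularSolution.antitoneOn_mul_exp_sub {Λ : ℝ} {J : Set ℝ} (sol : RegularSolution Λ J)
    {a b : ℝ} (hJ : Icc a b ⊆ J) (x : ℝ) :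
    AntitoneOn (fun τ => τ * Real.exp (-2 * sol.η τ x) - Λ / 3 * τ ^ 3) (Icc a b) := by
  have hder : ∀ τ ∈ interior (Icc a b),
      HasDerivAt (fun τ => τ * Real.exp (-2 * sol.η τ x) - Λ / 3 * τ ^ 3)
        (-(4 * Real.pi * τ ^ 2 * (sol.r τ x + sol.s τ x))) τ := fun τ hτ => by
    have hη := sol.hasDerivAt_η_time
      (Filter.mem_of_superset (mem_interior_iff_mem_nhds.mp hτ) hJ) x
    have h := ((hasDerivAt_id τ).mul (hη.const_mul (-2)).exp).sub
      ((hasDerivAt_pow 3 τ).const_mul (Λ / 3))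
    refine h.congr_deriv ?_
    have hE := sol.eqE2 τ (hJ (interior_subset hτ)) x
    simp only [id]
    push_cast
    linear_combination -hE
  have hc := (sol.continuousOn_η_time x).mono hJ
  refine antitoneOn_of_deriv_nonpos (convex_Icc a b) (by fun_prop)
    (fun τ hτ => (hder τ hτ).differentiableAt.differentiableWithinAt) fun τ hτ => ?_
  rw [(hder τ hτ).deriv]
  have hτJ := hJ (interior_subset hτ)
  have hr := sol.r_nonneg τ hτJ x
  have hs := sol.s_nonneg τ hτJ x
  exact neg_nonpos.mpr (by positivity)

/-- Lower bound for the lapse. -/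
theorem lapse_lower_bound (Λ : ℝ) (hΛ : 0 < Λ) (T : EReal) (hT : 1 < T)
    (sol : RegularSolution Λ (timeSlab T)) :
    ∀ t ∈ timeSlab T, ∀ x : ℝ,
      t / ((⨆ y : ℝ, Real.exp (-2 * sol.η 1 y)) + Λ / 3 * t ^ 3)
        ≤ Real.exp (2 * sol.η t x) := by
  intro t ht x
  have hJ : Icc 1 t ⊆ timeSlab T := fun τ hτ =>
    ⟨hτ.1, (EReal.coe_le_coe_iff.mpr hτ.2).trans_lt ht.2⟩
  have h1 : (1 : ℝ) ∈ Icc 1 t := left_mem_Icc.mpr ht.1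
  have hmono := sol.antitoneOn_mul_exp_sub hJ x h1 (right_mem_Icc.mpr ht.1) ht.1
  have hsup := le_ciSup (sol.bddAbove_exp_neg_two_η (hJ h1)) x
  have hC := (Real.exp_pos _).trans_le hsup
  have ht0 : 0 < t := zero_lt_one.trans_le ht.1
  have hkey : t * Real.exp (-2 * sol.η t x)
      ≤ (⨆ y : ℝ, Real.exp (-2 * sol.η 1 y)) + Λ / 3 * t ^ 3 := by
    norm_num at hmono hsup ⊢
    linarith
  rw [div_le_iff₀ (by positivity)]
  calc t = Real.exp (2 * sol.η t x) * (t * Real.exp (-2 * sol.η t x)) := by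
        rw [mul_left_comm, ← Real.exp_add]; simp
    _ ≤ _ := mul_le_mul_of_nonneg_left hkey (Real.exp_pos _).le
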